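/- The minimal-length coset representatives of the tuples δ¹ = ((m+1)̄ | 2 | 3 | ⋯ | m) and δ^j = (j̄ | 2 | ⋯ | j−1 | 1 | j+1 | ⋯ | m) for 2 ≤ j ≤ m all have length 2n: ℓ(w_{δ¹}) = 2n and ℓ(w_{δ^j}) = 2n for every 2 ≤ j ≤ m. -/

import Mathlib

/-- Roots of `R⁺ \ R_P⁺`: the formal symbols `t_i - t_j`, `t_i + t_j` and `2 t_i`. -/
inductive OddRoot : Type where
  | tminus (i j : ℕ) : OddRoot
  | tplus (i j : ℕ) : OddRoot
  | double (i : ℕ) : OddRoot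
deriving DecidableEq

namespace OddRoot

/-- The conditions for a formal symbol to be a root of `R⁺ \ R_P⁺`. -/
def valid (n m : ℕ) : OddRoot → Prop
  | tminus i j => 1 ≤ i ∧ i ≤ m ∧ i < j ∧ j ≤ n + 1
  | tplus i j => 1 ≤ i ∧ i ≤ m ∧ i < j ∧ j ≤ n + 1
  | double i => 1 ≤ i ∧ i ≤ m

/-- The reflection associated to a root, as a (signed) permutation of the
ground set `{1,…,2n+2}` inside `ℕ`, where `ī = 2n+3-i`. -/
def refl (n : ℕ) : OddRoot → Equiv.Perm ℕ
  | tminus i j => Equiv.swap i j * Equiv.swap (2*n+3-i) (2*n+3-j)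
  | tplus i j => Equiv.swap i (2*n+3-j) * Equiv.swap j (2*n+3-i)
  | double i => Equiv.swap i (2*n+3-i)

/-- The degree vector of a root: `deg α k` is the coefficient of the `k`-th
simple coroot in `α∨`. -/
def deg : OddRoot → ℕ → ℤ
  | tminus i j, k => if i ≤ k ∧ k < j then 1 else 0
  | tplus i j, k => (if i ≤ k then (1:ℤ) else 0) + (if j ≤ k then 1 else 0)
  | double i, k => if i ≤ k then 1 else 0

end OddRoot

/-- The total degree of a chain of roots. -/
def chainDeg (L : List OddRoot) (k : ℕ) : ℤ := (L.map (fun α => α.deg k)).sum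

/-- `IsChainTo n m L lam` : the sequence of roots `L = [α₁,…,α_t]` is a chain from the
identity coset to the tuple `lam`, i.e. each `αᵢ` is in `R⁺ \ R_P⁺` and the composite
`w = s_{α₁} ∘ ⋯ ∘ s_{α_t}` satisfies `w i = lam i` for `1 ≤ i ≤ m`. -/
def IsChainTo (n m : ℕ) (L : List OddRoot) (lam : ℕ → ℕ) : Prop :=
  (∀ α ∈ L, α.valid n m) ∧
  ∀ i ∈ Finset.Icc 1 m, ((L.map (OddRoot.refl n)).prod) i = lam i

/-- `W^odd`: tuples `(lam 1, …, lam m)` of pairwise distinct elements of `{1,…,2n+1}`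
with no two entries summing to `2n+3`. -/
def Wodd (n m : ℕ) (lam : ℕ → ℕ) : Prop :=
  (∀ i ∈ Finset.Icc 1 m, lam i ∈ Finset.Icc 1 (2*n+1)) ∧
  (∀ i ∈ Finset.Icc 1 m, ∀ j ∈ Finset.Icc 1 m, i ≠ j → lam i ≠ lam j) ∧
  (∀ i ∈ Finset.Icc 1 m, ∀ j ∈ Finset.Icc 1 m, lam i + lam j ≠ 2*n+3)

/-- `LamEntry lam k i = Λᵏᵢ`, the `i`-th smallest element of `{lam 1, …, lam k}`. -/
def LamEntry (lam : ℕ → ℕ) (k i : ℕ) : ℕ :=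
  (((Finset.Icc 1 k).image lam).sort (· ≤ ·)).getD (i-1) 0

/-- The Bruhat-type order `λ ⪯ δ`: `Λᵏᵢ ≤ Δᵏᵢ` for all `1 ≤ i ≤ k ≤ m`. -/
def Dominates (m : ℕ) (lam del : ℕ → ℕ) : Prop :=
  ∀ k ∈ Finset.Icc 1 m, ∀ i ∈ Finset.Icc 1 k, LamEntry lam k i ≤ LamEntry del k i

/-- The tuples `δʲ`: `δ¹ = ((m+1)̄ | 2 | 3 | ⋯ | m)` and, for `2 ≤ j ≤ m`,
`δʲ = (j̄ | 2 | ⋯ | j-1 | 1 | j+1 | ⋯ | m)`. -/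
def delta (n m j : ℕ) : ℕ → ℕ := fun i =>
  if j = 1 then (if i = 1 then 2*n+2-m else i)
  else if i = 1 then 2*n+3-j else if i = j then 1 else i

/-- The pattern vector `(0^a 1^b c^(m-a-b))`. -/
def patvec (a b : ℕ) (c : ℤ) : ℕ → ℤ := fun k =>
  if k ≤ a then 0 else if k ≤ a + b then 1 else c

/-- The simple reflections `s_k` (`1 ≤ k ≤ n`, swapping `k ↔ k+1` and `k̄ ↔ (k+1)̄`)
and `s_{n+1}` (swapping `n+1 ↔ (n+1)̄ = n+2`). -/
def simpleRefl (n k : ℕ) : Equiv.Perm ℕ :=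
  if k ≤ n then Equiv.swap k (k+1) * Equiv.swap (2*n+3-k) (2*n+2-k)
  else Equiv.swap (n+1) (n+2)

theorem simpleRefl_apply_le (n k x : ℕ) (h1 : 1 ≤ k) (hk : k ≤ n) :
    simpleRefl n k x = if x = k then k+1 else if x = k+1 then k else
      if x = 2*n+3-k then 2*n+2-k else if x = 2*n+2-k then 2*n+3-k else x := by
  simp only [simpleRefl, if_pos hk, Equiv.Perm.mul_apply, Equiv.swap_apply_def]
  split_ifs <;> omega

theorem simpleRefl_apply_last (n x : ℕ) :
    simpleRefl n (n+1) x = if x = n+1 then n+2 else if x = n+2 then n+1 else x := by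
  have h : ¬ (n+1 ≤ n) := by omega
  simp only [simpleRefl, if_neg h, Equiv.swap_apply_def]

/-- The potential function can grow by at most one in each step. -/
theorem potential_step (n k a b : ℕ) (hk1 : 1 ≤ k) (hk : k ≤ n+1)
    (ha1 : 1 ≤ a) (ha2 : a ≤ 2*n+2) (hb1 : 1 ≤ b) (hb2 : b ≤ 2*n+2) (hab : a ≠ b)
    (hab2 : a + b ≠ 2*n+3) (a' b' : ℕ) (ha' : simpleRefl n k a = a')
    (hb' : simpleRefl n k b = b') :
    1 ≤ a' ∧ a' ≤ 2*n+2 ∧ 1 ≤ b' ∧ b' ≤ 2*n+2 ∧ a' ≠ b' ∧ a' + b' ≠ 2*n+3 ∧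
    ((a':ℤ) - b' - (if b' < a' then 1 else 0) ≤ (a:ℤ) - b - (if b < a then 1 else 0) + 1) := by
  rcases Nat.lt_or_ge n k with h | h
  · obtain rfl : k = n+1 := by omega
    rw [simpleRefl_apply_last] at ha' hb'
    refine ⟨?_, ?_, ?_, ?_, ?_, ?_, ?_⟩ <;> split_ifs at * <;> omega
  · rw [simpleRefl_apply_le n k _ hk1 h] at ha' hb'
    refine ⟨?_, ?_, ?_, ?_, ?_, ?_, ?_⟩ <;> split_ifs at * <;> omega

theorem potential_list (n p : ℕ) (hp : 2 ≤ p) (hpn : p ≤ n+1) (Ls : List ℕ) :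
    (∀ k ∈ Ls, 1 ≤ k ∧ k ≤ n+1) → ∀ a b : ℕ, (Ls.map (simpleRefl n)).prod 1 = a →
    (Ls.map (simpleRefl n)).prod p = b →
    1 ≤ a ∧ a ≤ 2*n+2 ∧ 1 ≤ b ∧ b ≤ 2*n+2 ∧ a ≠ b ∧ a + b ≠ 2*n+3 ∧
    ((a:ℤ) - b - (if b < a then 1 else 0) ≤ 1 - p + Ls.length) := by
  induction Ls with
  | nil =>
    intro _ a b ha hb
    simp at ha hb
    subst ha hb
    refine ⟨?_, ?_, ?_, ?_, ?_, ?_, ?_⟩ <;> (try split_ifs) <;> (try simp only [List.length_nil]) <;> omega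
  | cons k L ih =>
    intro hL a b ha hb
    obtain ⟨h1, h2, h3, h4, h5, h6, h7⟩ :=
      ih (fun q hq => hL q (List.mem_cons_of_mem _ hq)) _ _ rfl rfl
    have hk := hL k List.mem_cons_self
    simp only [List.map_cons, List.prod_cons, Equiv.Perm.mul_apply] at ha hb
    obtain ⟨g1, g2, g3, g4, g5, g6, g7⟩ :=
      potential_step n k _ _ hk.1 hk.2 h1 h2 h3 h4 h5 h6 a b ha hb
    refine ⟨g1, g2, g3, g4, g5, g6, ?_⟩
    simp only [List.length_cons]
    push_cast
    linarith

/-- The ascending product `s_a s_{a+1} ⋯ s_{a+c-1}`. -/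
theorem asc_apply (n c : ℕ) : ∀ a x : ℕ, 1 ≤ a → a + c ≤ n+1 →
    ((List.range' a c).map (simpleRefl n)).prod x =
      if x = a + c then a else if a ≤ x ∧ x < a + c then x + 1 else
      if x = 2*n+3-(a+c) then 2*n+3-a else
      if 2*n+3-(a+c) < x ∧ x ≤ 2*n+3-a then x - 1 else x := by
  induction c with
  | zero =>
    intro a x ha hac
    simp
    split_ifs <;> omega
  | succ c ih =>
    intro a x ha hac
    rw [List.range'_succ, List.map_cons, List.prod_cons, Equiv.Perm.mul_apply,
      ih (a+1) x (by omega) (by omega), simpleRefl_apply_le n a _ ha (by omega)]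
    split_ifs <;> omega

/-- The descending product `s_c ⋯ s_2 s_1`. -/
theorem desc_apply (n c : ℕ) : ∀ x : ℕ, c ≤ n →
    (((List.range' 1 c).reverse).map (simpleRefl n)).prod x =
      if x = 1 then c + 1 else if 2 ≤ x ∧ x ≤ c + 1 then x - 1 else
      if x = 2*n+2 then 2*n+2-c else
      if 2*n+2-c ≤ x ∧ x < 2*n+2 then x + 1 else x := by
  induction c with
  | zero =>
    intro x hc
    simp
    split_ifs <;> omega
  | succ c ih =>
    intro x hc
    rw [List.range'_concat, List.reverse_append, List.reverse_singleton, List.singleton_append,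
      List.map_cons, List.prod_cons, Equiv.Perm.mul_apply,
      ih x (by omega), simpleRefl_apply_le n _ _ (by omega) (by omega)]
    split_ifs <;> omega

theorem word_apply (n p x : ℕ) (hp : 2 ≤ p) (hpn : p ≤ n+1) :
    ((List.range' 1 (p-2) ++ (List.range' p (n+1-p) ++ ([n+1] ++
      (List.range' 1 n).reverse))).map (simpleRefl n)).prod x =
    if x = 1 then 2*n+3-p else if x = p then 1 else if x = 2*n+3-p then 2*n+2 else
      if x = 2*n+2 then p else x := by
  rw [List.map_append, List.prod_append, List.map_append, List.prod_append,
    List.map_append, List.prod_append, Equiv.Perm.mul_apply, Equiv.Perm.mul_apply,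
    Equiv.Perm.mul_apply, desc_apply n n x le_rfl]
  simp only [List.map_cons, List.map_nil, List.prod_singleton]
  obtain ⟨y, hy⟩ : ∃ y, y = (if x = 1 then n + 1 else if 2 ≤ x ∧ x ≤ n + 1 then x - 1 else
      if x = 2*n+2 then 2*n+2-n else
      if 2*n+2-n ≤ x ∧ x < 2*n+2 then x + 1 else x) := ⟨_, rfl⟩
  rw [← hy, simpleRefl_apply_last]
  obtain ⟨z, hz⟩ : ∃ z, z = (if y = n+1 then n+2 else if y = n+2 then n+1 else y) := ⟨_, rfl⟩
  rw [← hz]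
  have hz' : z = if x = 1 then n + 2 else if 2 ≤ x ∧ x ≤ n + 1 then x - 1 else
      if x = 2*n+2 then n + 1 else
      if n+2 ≤ x ∧ x < 2*n+2 then x + 1 else x := by
    split_ifs at * <;> omega
  clear hz hy
  rw [asc_apply n (n+1-p) p z (by omega) (by omega)]
  obtain ⟨u, hu⟩ : ∃ u, u = (if z = p + (n+1-p) then p else
      if p ≤ z ∧ z < p + (n+1-p) then z + 1 else
      if z = 2*n+3-(p + (n+1-p)) then 2*n+3-p else
      if 2*n+3-(p + (n+1-p)) < z ∧ z ≤ 2*n+3-p then z - 1 else z) := ⟨_, rfl⟩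
  rw [← hu]
  have hu' : u = if x = 1 then 2*n+3-p else if 2 ≤ x ∧ x ≤ p then x - 1 else
      if x = 2*n+2 then p else
      if 2*n+3-p ≤ x ∧ x < 2*n+2 then x + 1 else x := by
    split_ifs at * <;> omega
  clear hu hz'
  rw [asc_apply n (p-2) 1 u (by omega) (by omega)]
  split_ifs at * <;> omega

theorem main_aux (n p : ℕ) (hp : 2 ≤ p) (hpn : p ≤ n+1) (w : Equiv.Perm ℕ)
    (hw : ∀ x, w x = if x = 1 then 2*n+3-p else if x = p then 1 else
      if x = 2*n+3-p then 2*n+2 else if x = 2*n+2 then p else x) :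
    (∃ Ls : List ℕ, Ls.length = 2*n ∧ (∀ k ∈ Ls, 1 ≤ k ∧ k ≤ n+1) ∧
        (Ls.map (simpleRefl n)).prod = w) ∧
    (∀ Ls : List ℕ, (∀ k ∈ Ls, 1 ≤ k ∧ k ≤ n+1) → (Ls.map (simpleRefl n)).prod = w →
        2*n ≤ Ls.length) := by
  constructor
  · refine ⟨_, ?_, ?_, Equiv.ext fun x => (word_apply n p x hp hpn).trans (hw x).symm⟩
    · simp
      omega
    · intro k hk
      simp only [List.mem_append, List.mem_reverse, List.mem_range'_1, List.mem_singleton] at hk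
      omega
  · intro Ls hLs hprod
    obtain ⟨_, _, _, _, _, _, h⟩ := potential_list n p hp hpn Ls hLs (2*n+3-p) 1
      (by rw [hprod, hw]; simp) (by rw [hprod, hw]; split_ifs <;> omega)
    split_ifs at h <;> omega

theorem form_aux (n m p : ℕ) (hp : 2 ≤ p) (hmn : m ≤ n) (hpm : p ≤ m+1)
    (w : Equiv.Perm ℕ)
    (hfix : ∀ x : ℕ, x ∉ Finset.Icc 1 (2*n+2) → w x = x)
    (hsigned : ∀ i ∈ Finset.Icc 1 (2*n+2), w (2*n+3-i) = 2*n+3 - w i)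
    (h1 : w 1 = 2*n+3-p)
    (hlow : ∀ i, 2 ≤ i → i ≤ m → i ≠ p → w i = i)
    (hwp : p ≤ m → w p = 1)
    (hinc : ∀ i : ℕ, m+1 ≤ i → i ≤ n → w i < w (i+1))
    (hlast : w (n+1) ≤ n+1) (x : ℕ) :
    w x = if x = 1 then 2*n+3-p else if x = p then 1 else
      if x = 2*n+3-p then 2*n+2 else if x = 2*n+2 then p else x := by
  have hup : ∀ d i, i + d = n+1 → m+1 ≤ i → w i ≤ i := by
    intro d
    induction d with
    | zero => intro i hi _; obtain rfl : i = n+1 := by omega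
              exact hlast
    | succ d ih =>
      intro i hi hm
      have := ih (i+1) (by omega) (by omega)
      have := hinc i hm (by omega)
      omega
  have hw0 : w 0 = 0 := hfix 0 (by simp)
  have hlastv : w (2*n+2) = p := by
    have := hsigned 1 (by simp)
    rw [h1] at this
    have e : 2*n+3-1 = 2*n+2 := by omega
    rw [e] at this
    omega
  have inj : ∀ a b, w a = w b → a = b := fun a b h => w.injective h
  have hp1 : w p = 1 := by
    by_cases h : p ≤ m
    · exact hwp h
    · have hpe : p = m+1 := by omega
      have hle := hup (n+1-p) p (by omega) (by omega)
      have a0 : w p ≠ 0 := fun h => by have := inj p 0 (by omega); omega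
      have a1 : w p ≠ p := fun h => by have := inj p (2*n+2) (by omega); omega
      by_contra hne
      have := inj _ _ (hlow (w p) (by omega) (by omega) (by omega))
      omega
  have hid : ∀ i, 2 ≤ i → i ≤ n+1 → i ≠ p → w i = i := by
    intro i
    induction i using Nat.strong_induction_on with
    | _ i ih =>
      intro hi hin hip
      by_cases him : i ≤ m
      · exact hlow i hi him hip
      · have hle := hup (n+1-i) i (by omega) (by omega)
        have a0 : w i ≠ 0 := fun h => by have := inj i 0 (by omega); omega
        have a1 : w i ≠ 1 := fun h => by have := inj i p (by omega); omega
        have a2 : w i ≠ p := fun h => by have := inj i (2*n+2) (by omega); omega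
        by_contra hne
        have := inj _ _ (ih (w i) (by omega) (by omega) (by omega) a2)
        omega
  have hhalf : ∀ i, 1 ≤ i → i ≤ n+1 → w i = if i = 1 then 2*n+3-p else if i = p then 1 else i := by
    intro i hi hin
    split_ifs with e1 e2
    · rw [e1, h1]
    · rw [e2, hp1]
    · exact hid i (by omega) hin e2
  by_cases hx : x ∈ Finset.Icc 1 (2*n+2)
  · rw [Finset.mem_Icc] at hx
    by_cases hxn : x ≤ n+1
    · rw [hhalf x hx.1 hxn]
      split_ifs <;> omega
    · have := hsigned (2*n+3-x) (by rw [Finset.mem_Icc]; omega)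
      rw [hhalf (2*n+3-x) (by omega) (by omega)] at this
      have e : 2*n+3-(2*n+3-x) = x := by omega
      rw [e] at this
      rw [this]
      split_ifs <;> omega
  · rw [hfix x hx]
    rw [Finset.mem_Icc] at hx
    split_ifs <;> omega

/-- Lemma `lem:length`: the minimal-length coset representative of each of
the tuples `δ¹, δ², …, δᵐ` has length `2n`. Here `w` is the minimal-length representative:
the signed permutation of the ground set `{1,…,2n+2}` with `w i = δʲ i` for `1 ≤ i ≤ m` and
`w (m+1) < w (m+2) < ⋯ < w (n+1) ≤ n+1`, and the length of `w` is the least `t` such that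
`w` is a product of `t` simple reflections. -/
theorem length_of_delta (n m : ℕ) (hn : 1 ≤ n) (hm : 1 ≤ m) (hmn : m ≤ n)
    (j : ℕ) (hj1 : 1 ≤ j) (hjm : j ≤ m)
    (w : Equiv.Perm ℕ)
    (hfix : ∀ x : ℕ, x ∉ Finset.Icc 1 (2*n+2) → w x = x)
    (hsigned : ∀ i ∈ Finset.Icc 1 (2*n+2), w (2*n+3-i) = 2*n+3 - w i)
    (hval : ∀ i ∈ Finset.Icc 1 m, w i = delta n m j i)
    (hinc : ∀ i : ℕ, m+1 ≤ i → i ≤ n → w i < w (i+1))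
    (hlast : w (n+1) ≤ n+1) :
    (∃ Ls : List ℕ, Ls.length = 2*n ∧ (∀ k ∈ Ls, 1 ≤ k ∧ k ≤ n+1) ∧
        (Ls.map (simpleRefl n)).prod = w) ∧
    (∀ Ls : List ℕ, (∀ k ∈ Ls, 1 ≤ k ∧ k ≤ n+1) → (Ls.map (simpleRefl n)).prod = w →
        2*n ≤ Ls.length) := by
  by_cases hj : j = 1
  · refine main_aux n (m+1) (by omega) (by omega) w
      (form_aux n m (m+1) (by omega) hmn le_rfl w hfix hsigned ?_ ?_ (by omega) hinc hlast)
    · rw [hval 1 (by simp; omega)]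
      simp [delta, hj]
    · intro i hi him _
      rw [hval i (by simp; omega)]
      have : i ≠ 1 := by omega
      simp [delta, hj, this]
  · refine main_aux n j (by omega) (by omega) w
      (form_aux n m j (by omega) hmn (by omega) w hfix hsigned ?_ ?_ ?_ hinc hlast)
    · rw [hval 1 (by simp; omega)]
      simp [delta, hj]
    · intro i hi him hij
      rw [hval i (by simp; omega)]
      have : i ≠ 1 := by omega
      simp [delta, hj, this, hij]
    · intro _
      rw [hval j (by simp; omega)]
      simp [delta, hj]
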